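/- Let Ω = ℝ^d/ℤ^d, let h : Ω → ℝ be a continuous L-Lipschitz kernel with ĥ(ξ) ≠ 0 for all ξ ∈ ℤ^d, and let π be a Borel probability measure on Ω. Then for every N the projection problem min over N-point measures μ ∈ 𝓜(Ω^N) of N_h(π − μ) admits a solution μ*_N; moreover (i) μ*_N converges weakly to π as N → ∞, and (ii) N_h(μ*_N − π) = O(L · N^{−1/d}). -/

import Mathlib

open MeasureTheory Filter Topology
open scoped NNReal ENNReal

noncomputable section

/-- The `d`-dimensional torus `Ω = ℝ^d/ℤ^d`. -/
abbrev Torus (d : ℕ) : Type := Fin d → AddCircle (1 : ℝ)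

/-- Convolution `(h ⋆ μ)(x) = ∫ h(x−y) dμ(y)` of a function with a finite signed
measure, via the Jordan decomposition of `μ`. -/
def convSigned {d : ℕ} (h : Torus d → ℝ) (μ : SignedMeasure (Torus d)) (x : Torus d) : ℝ :=
  ∫ y, h (x - y) ∂μ.toJordanDecomposition.posPart -
    ∫ y, h (x - y) ∂μ.toJordanDecomposition.negPart

/-- `N_h(μ) = ‖h ⋆ μ‖_{L²(Ω)}` for a signed measure `μ`. -/
def nhSigned {d : ℕ} (h : Torus d → ℝ) (μ : SignedMeasure (Torus d)) : ℝ :=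
  Real.sqrt (∫ x, (convSigned h μ x) ^ 2)

/-- The total variation norm `‖μ‖_TV` of a signed measure. -/
def tvNorm {d : ℕ} (μ : SignedMeasure (Torus d)) : ℝ := (μ.totalVariation Set.univ).toReal

/-- The integral `∫ f dμ` of a function against a signed measure. -/
def signedIntegral {d : ℕ} (μ : SignedMeasure (Torus d)) (f : Torus d → ℝ) : ℝ :=
  ∫ y, f y ∂μ.toJordanDecomposition.posPart - ∫ y, f y ∂μ.toJordanDecomposition.negPart

/-- The Fourier coefficient `ĥ(ξ) = ∫_Ω e^{−2πi⟨ξ,x⟩} h(x) dx`, `ξ ∈ ℤ^d`. -/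
def torusFourierCoeff {d : ℕ} (h : Torus d → ℝ) (ξ : Fin d → ℤ) : ℂ :=
  ∫ x : Torus d, (∏ i, fourier (-(ξ i)) (x i)) * (h x : ℂ)

/-- `(h ⋆ (μ − ν))(x)` for two (finite) measures `μ, ν`. -/
def convDiff {d : ℕ} (h : Torus d → ℝ) (μ ν : Measure (Torus d)) (x : Torus d) : ℝ :=
  ∫ y, h (x - y) ∂μ - ∫ y, h (x - y) ∂ν

/-- `N_h(μ − ν) = ‖h ⋆ (μ − ν)‖_{L²(Ω)}`. -/
def nhDist {d : ℕ} (h : Torus d → ℝ) (μ ν : Measure (Torus d)) : ℝ :=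
  Real.sqrt (∫ x, (convDiff h μ ν x) ^ 2)

/-- The L¹ Wasserstein (Kantorovich) distance: infimum of `∫ dist(x,y) dc` over
all couplings `c` of `μ` and `ν`. -/
def W1 {d : ℕ} (μ ν : Measure (Torus d)) : ℝ :=
  sInf { r | ∃ c : Measure (Torus d × Torus d),
    c.map Prod.fst = μ ∧ c.map Prod.snd = ν ∧ r = ∫ p, dist p.1 p.2 ∂c }

/-- The set `𝓜(Ω^N)` of `N`-point measures `(1/N) ∑ δ_{p_i}`. -/
def nPointMeasures (d N : ℕ) : Set (Measure (Torus d)) :=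
  { μ | ∃ p : Fin N → Torus d, μ = (N : ℝ≥0∞)⁻¹ • ∑ i, Measure.dirac (p i) }

/-- Hausdorff distance between two sets of measures with respect to the metric
`(μ, ν) ↦ N_h(μ − ν)`. -/
def hausNh {d : ℕ} (h : Torus d → ℝ) (A B : Set (Measure (Torus d))) : ℝ :=
  max (sSup ((fun μ => sInf ((fun ν => nhDist h μ ν) '' B)) '' A))
      (sSup ((fun ν => sInf ((fun μ => nhDist h μ ν) '' A)) '' B))

theorem sum_telescope_mul (D g : ℕ → ℝ) (h0 : D 0 = 0) (M : ℕ) :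
    ∑ n ∈ Finset.range M, (D (n + 1) - D n) * g n =
      D M * g M - ∑ n ∈ Finset.range M, D (n + 1) * (g (n + 1) - g n) := by
  induction M with
  | zero => simp [h0]
  | succ k ih => rw [Finset.sum_range_succ, Finset.sum_range_succ, ih]; ring

/-- Rounding the cumulative sums of a probability vector to multiples of `1/N`. -/
theorem exists_rounding {M N : ℕ} (hN : 0 < N) (w : ℕ → ℝ) (hw : ∀ n, 0 ≤ w n)
    (hw1 : ∑ n ∈ Finset.range M, w n = 1) :
    ∃ c : ℕ → ℕ, ∑ n ∈ Finset.range M, c n = N ∧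
      ∀ (g : ℕ → ℝ) (K : ℝ), (∀ n, |g (n + 1) - g n| ≤ K) →
        |(N : ℝ)⁻¹ * ∑ n ∈ Finset.range M, c n * g n - ∑ n ∈ Finset.range M, w n * g n|
          ≤ M * ((N : ℝ)⁻¹ * K) := by
  have hN' : (0 : ℝ) < N := by exact_mod_cast hN
  set F : ℕ → ℝ := fun n => ∑ k ∈ Finset.range n, w k with hF
  have hF0 : ∀ n, 0 ≤ F n := fun n => Finset.sum_nonneg fun k _ => hw k
  have hFs : ∀ n, F (n + 1) = F n + w n := fun n => Finset.sum_range_succ _ _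
  have hmono : Monotone fun n => ⌊(N : ℝ) * F n⌋₊ := by
    refine monotone_nat_of_le_succ fun n => Nat.floor_mono ?_
    have := hw n
    rw [hFs]
    gcongr
    linarith
  have hFM : F M = 1 := hw1
  refine ⟨fun n => ⌊(N : ℝ) * F (n + 1)⌋₊ - ⌊(N : ℝ) * F n⌋₊, ?_, fun g K hg => ?_⟩
  · rw [Finset.sum_range_tsub hmono, hFM]
    simp [hF]
  set D : ℕ → ℝ := fun n => (N : ℝ)⁻¹ * ⌊(N : ℝ) * F n⌋₊ - F n with hD
  have hD0 : D 0 = 0 := by simp [hD, hF]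
  have hDM : D M = 0 := by simp [hD, hFM, hN'.ne']
  have hDabs : ∀ n, |D n| ≤ (N : ℝ)⁻¹ := by
    intro n
    have h1 := Nat.floor_le (mul_nonneg hN'.le (hF0 n))
    have h2 := Nat.lt_floor_add_one ((N : ℝ) * F n)
    have h3 : D n = (N : ℝ)⁻¹ * (⌊(N : ℝ) * F n⌋₊ - N * F n) := by
      simp only [hD]; field_simp
    rw [h3, abs_mul, abs_of_pos (inv_pos.2 hN')]
    refine mul_le_of_le_one_right (inv_pos.2 hN').le (abs_le.2 ⟨?_, ?_⟩) <;> linarith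
  have key : (N : ℝ)⁻¹ * ∑ n ∈ Finset.range M,
        ((⌊(N : ℝ) * F (n + 1)⌋₊ - ⌊(N : ℝ) * F n⌋₊ : ℕ) : ℝ) * g n
      - ∑ n ∈ Finset.range M, w n * g n =
      - ∑ n ∈ Finset.range M, D (n + 1) * (g (n + 1) - g n) := by
    have := sum_telescope_mul D g hD0 M
    rw [hDM, zero_mul, zero_sub] at this
    rw [← this, Finset.mul_sum, ← Finset.sum_sub_distrib]
    refine Finset.sum_congr rfl fun n _ => ?_
    rw [Nat.cast_sub (hmono n.le_succ)]
    simp only [hD, hFs]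
    ring
  rw [key, abs_neg]
  refine (Finset.abs_sum_le_sum_abs _ _).trans ?_
  refine (Finset.sum_le_card_nsmul _ _ ((N : ℝ)⁻¹ * K) fun n _ => ?_).trans (by simp)
  rw [abs_mul]
  gcongr
  · exact hDabs _
  · exact hg n

/-- Points of multiplicities `c n`, listed as a family indexed by `Fin N`. -/
theorem exists_fin_family_of_multiplicities {M N : ℕ} (c : ℕ → ℕ)
    (hc : ∑ n ∈ Finset.range M, c n = N) :
    ∃ q : Fin N → ℕ, ∀ g : ℕ → ℝ,
      ∑ i, g (q i) = ∑ n ∈ Finset.range M, c n * g n := by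
  have hcard : Fintype.card (Σ n : Fin M, Fin (c n)) = N := by
    simp [← hc, Finset.sum_range]
  let e := Fintype.equivFinOfCardEq hcard
  refine ⟨fun i => (e.symm i).1, fun g => ?_⟩
  rw [Equiv.sum_comp e.symm (fun s => g s.1), Fintype.sum_sigma, Finset.sum_range]
  simp

/-- Lexicographic enumeration of the grid of mesh `1/m` in the torus. -/
def gridPoint (d m n : ℕ) : Torus d := fun j => (((n / m ^ (j : ℕ) : ℕ) : ℝ) / m : ℝ)

theorem dist_addCircle_coe_le (a b : ℝ) :
    dist (a : AddCircle (1 : ℝ)) (b : AddCircle (1 : ℝ)) ≤ |a - b| := by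
  rw [dist_eq_norm, ← AddCircle.coe_sub]
  exact QuotientAddGroup.norm_mk_le_norm

theorem dist_gridPoint_succ_le (d m n : ℕ) :
    dist (gridPoint d m (n + 1)) (gridPoint d m n) ≤ 1 / m := by
  refine (dist_pi_le_iff (by positivity)).2 fun j => ?_
  refine (dist_addCircle_coe_le _ _).trans ?_
  rw [← sub_div, abs_div, Nat.abs_cast]
  gcongr
  rw [Nat.succ_div]
  split_ifs <;> simp

theorem exists_gridPoint_near {d m : ℕ} (hm : 0 < m) (x : Torus d) :
    ∃ n < m ^ d, dist x (gridPoint d m n) ≤ 1 / m := by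
  have hm' : (0 : ℝ) < m := by exact_mod_cast hm
  have hx : ∀ j, ∃ a : Fin m, dist (x j) (((a : ℝ) / m : ℝ) : AddCircle (1 : ℝ)) ≤ 1 / m := by
    intro j
    obtain ⟨t, ht, htx⟩ : ∃ t ∈ Set.Ico (0 : ℝ) 1, (t : AddCircle (1 : ℝ)) = x j := by
      have := AddCircle.coe_image_Ico_eq (1 : ℝ) 0
      have h2 : x j ∈ ((↑) : ℝ → AddCircle (1 : ℝ)) '' Set.Ico 0 (0 + 1) := by rw [this]; trivial
      simpa using h2
    have h0 : 0 ≤ (m : ℝ) * t := mul_nonneg hm'.le ht.1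
    have hlt : ⌊(m : ℝ) * t⌋₊ < m := by
      rw [Nat.floor_lt h0]
      nlinarith [ht.2]
    refine ⟨⟨_, hlt⟩, ?_⟩
    rw [← htx]
    refine (dist_addCircle_coe_le _ _).trans ?_
    have h1 := Nat.floor_le h0
    have h2 := Nat.lt_floor_add_one ((m : ℝ) * t)
    have h3 : t - (⌊(m : ℝ) * t⌋₊ : ℝ) / m = (m * t - ⌊(m : ℝ) * t⌋₊) / m := by field_simp
    simp only [h3]
    rw [abs_div, Nat.abs_cast]
    gcongr
    exact abs_le.2 ⟨by linarith, by linarith⟩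
  choose a ha using hx
  refine ⟨finFunctionFinEquiv a, (finFunctionFinEquiv a).2, ?_⟩
  refine (dist_pi_le_iff (by positivity)).2 fun j => ?_
  have h1 : (finFunctionFinEquiv a : ℕ) / m ^ (j : ℕ) % m = a j := by
    conv_rhs => rw [← finFunctionFinEquiv.symm_apply_apply a]
    rfl
  have h2 : gridPoint d m (finFunctionFinEquiv a) j = (((a j : ℕ) : ℝ) / m : ℝ) := by
    rw [← h1]
    set k := (finFunctionFinEquiv a : ℕ) / m ^ (j : ℕ) with hk
    have h4 : (k : ℝ) / m = ((k % m : ℕ) : ℝ) / m + ((k / m : ℕ) : ℝ) * 1 := by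
      have : (k : ℝ) = (k % m : ℕ) + m * (k / m : ℕ) := by exact_mod_cast (Nat.mod_add_div k m).symm
      field_simp
      linarith
    change (((k : ℝ) / m : ℝ) : AddCircle (1 : ℝ)) = _
    rw [h4, ← nsmul_eq_mul, AddCircle.coe_add, AddCircle.coe_nsmul, AddCircle.coe_period]
    simp
  rw [h2]
  exact ha j

theorem integral_nPoint {d N : ℕ} (p : Fin N → Torus d) (f : Torus d → ℝ) :
    ∫ y, f y ∂((N : ℝ≥0∞)⁻¹ • ∑ i, Measure.dirac (p i)) = (N : ℝ)⁻¹ * ∑ i, f (p i) := by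
  rw [integral_smul_measure, integral_finsetSum_measure]
  · simp [integral_dirac]
  · intro i _
    exact integrable_dirac (by simp [enorm_lt_top])

theorem exists_nPoint_near {d m N : ℕ} (hm : 0 < m) (hN : 0 < N) (hmN : m ^ d ≤ N)
    (π : Measure (Torus d)) [IsProbabilityMeasure π] :
    ∃ p : Fin N → Torus d, ∀ (L : ℝ≥0) (f : Torus d → ℝ), LipschitzWith L f →
      |(N : ℝ)⁻¹ * ∑ i, f (p i) - ∫ y, f y ∂π| ≤ L * (2 / m) := by
  classical
  have hN' : (0 : ℝ) < N := by exact_mod_cast hN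
  have hex : ∀ x : Torus d, ∃ n, n < m ^ d ∧ dist x (gridPoint d m n) ≤ 1 / m :=
    fun x => exists_gridPoint_near hm x
  let ψ : Torus d → ℕ := fun x => Nat.find (hex x)
  have hψm : Measurable ψ := by
    refine measurable_find hex fun n => ?_
    exact (MeasurableSet.const _).inter
      (isClosed_le (continuous_id.dist continuous_const) continuous_const).measurableSet
  have hψlt : ∀ x, ψ x < m ^ d := fun x => (Nat.find_spec (hex x)).1
  have hψd : ∀ x, dist x (gridPoint d m (ψ x)) ≤ 1 / m := fun x => (Nat.find_spec (hex x)).2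
  let w : ℕ → ℝ := fun n => π.real (ψ ⁻¹' {n})
  have hind : ∀ (g : ℕ → ℝ) (x : Torus d), g (ψ x) =
      ∑ n ∈ Finset.range (m ^ d), (ψ ⁻¹' {n}).indicator (fun _ => g n) x := by
    intro g x
    rw [Finset.sum_eq_single (ψ x)]
    · simp
    · intro b _ hb
      simp [Set.indicator_of_notMem, hb.symm]
    · intro h
      exact absurd (Finset.mem_range.2 (hψlt x)) h
  have hint : ∀ (g : ℕ → ℝ) (n : ℕ),
      Integrable ((ψ ⁻¹' {n}).indicator (fun _ => g n)) π := fun g n =>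
    (integrable_const _).indicator (hψm (measurableSet_singleton n))
  have hsum : ∀ g : ℕ → ℝ, ∫ y, g (ψ y) ∂π = ∑ n ∈ Finset.range (m ^ d), w n * g n := by
    intro g
    simp_rw [hind g]
    rw [integral_finsetSum _ fun n _ => hint g n]
    refine Finset.sum_congr rfl fun n _ => ?_
    rw [integral_indicator_const _ (hψm (measurableSet_singleton n))]
    rfl
  have hgint : ∀ g : ℕ → ℝ, Integrable (fun y => g (ψ y)) π := by
    intro g
    simp_rw [hind g]
    exact integrable_finsetSum _ fun n _ => hint g n
  have hw1 : ∑ n ∈ Finset.range (m ^ d), w n = 1 := by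
    have := hsum fun _ => 1
    simpa using this.symm
  obtain ⟨c, hcN, hc⟩ := exists_rounding hN w (fun _ => measureReal_nonneg) hw1
  obtain ⟨q, hq⟩ := exists_fin_family_of_multiplicities c hcN
  refine ⟨fun i => gridPoint d m (q i), fun L f hf => ?_⟩
  have hfint : Integrable f π := hf.continuous.integrable_of_hasCompactSupport
    (HasCompactSupport.of_compactSpace f)
  have h1 : |(N : ℝ)⁻¹ * ∑ i, f (gridPoint d m (q i)) - ∫ y, f (gridPoint d m (ψ y)) ∂π|
      ≤ L * (1 / m) := by
    rw [hq fun n => f (gridPoint d m n), hsum fun n => f (gridPoint d m n)]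
    refine (hc _ (L * (1 / m)) fun n => ?_).trans ?_
    · rw [← Real.dist_eq]
      exact (hf.dist_le_mul _ _).trans (by gcongr; exact dist_gridPoint_succ_le d m n)
    · rw [← mul_assoc]
      refine mul_le_of_le_one_left (by positivity) ?_
      rw [← div_eq_mul_inv, div_le_one hN']
      exact_mod_cast hmN
  have h2 : |∫ y, f (gridPoint d m (ψ y)) ∂π - ∫ y, f y ∂π| ≤ L * (1 / m) := by
    rw [← integral_sub (hgint fun n => f (gridPoint d m n)) hfint]
    rw [← Real.norm_eq_abs]
    refine (norm_integral_le_of_norm_le_const (μ := π) (C := L * (1 / m))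
      (ae_of_all _ fun y => ?_)).trans (by simp)
    rw [← dist_eq_norm, dist_comm]
    exact (hf.dist_le_mul _ _).trans (by gcongr; exact hψd y)
  have h3 := abs_sub_le ((N : ℝ)⁻¹ * ∑ i, f (gridPoint d m (q i)))
    (∫ y, f (gridPoint d m (ψ y)) ∂π) (∫ y, f y ∂π)
  have h4 : (L : ℝ) * (2 / m) = L * (1 / m) + L * (1 / m) := by ring
  linarith

instance isProbabilityMeasure_volume_addCircle :
    IsProbabilityMeasure (volume : Measure (AddCircle (1 : ℝ))) :=
  ⟨by simp [AddCircle.measure_univ]⟩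

theorem isProbabilityMeasure_of_mem_nPointMeasures {d N : ℕ} (hN : 0 < N)
    {μ : Measure (Torus d)} (hμ : μ ∈ nPointMeasures d N) : IsProbabilityMeasure μ := by
  obtain ⟨p, rfl⟩ := hμ
  constructor
  simp only [Measure.smul_apply, Measure.coe_finsetSum, Finset.sum_apply, measure_univ,
    Finset.sum_const, Finset.card_univ, Fintype.card_fin, smul_eq_mul, nsmul_eq_mul, mul_one]
  exact ENNReal.inv_mul_cancel (by exact_mod_cast hN.ne') (ENNReal.natCast_ne_top N)

theorem integrable_of_continuous {d : ℕ} {E : Type*} [NormedAddCommGroup E]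
    {f : Torus d → E} (hf : Continuous f) (μ : Measure (Torus d)) [IsFiniteMeasure μ] :
    Integrable f μ :=
  hf.integrable_of_hasCompactSupport (HasCompactSupport.of_compactSpace f)

theorem continuous_conv {d : ℕ} (h : C(Torus d, ℝ)) (μ : Measure (Torus d)) [IsFiniteMeasure μ] :
    Continuous fun x => ∫ y, h (x - y) ∂μ := by
  have := continuous_parametric_integral_of_continuous (μ := μ)
    (f := fun x y : Torus d => h (x - y)) (by fun_prop) isCompact_univ
  simpa using this

theorem continuous_convDiff {d : ℕ} (h : C(Torus d, ℝ)) (μ ν : Measure (Torus d))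
    [IsFiniteMeasure μ] [IsFiniteMeasure ν] : Continuous (convDiff h μ ν) :=
  (continuous_conv h μ).sub (continuous_conv h ν)

theorem nhDist_le_of_abs_convDiff_le {d : ℕ} (h : C(Torus d, ℝ)) (μ ν : Measure (Torus d))
    [IsFiniteMeasure μ] [IsFiniteMeasure ν] {B : ℝ} (hB : 0 ≤ B)
    (hle : ∀ x, |convDiff h μ ν x| ≤ B) : nhDist h μ ν ≤ B := by
  refine Real.sqrt_le_iff.2 ⟨hB, ?_⟩
  have := integral_mono (μ := (volume : Measure (Torus d)))
    (integrable_of_continuous ((continuous_convDiff h μ ν).pow 2) _)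
    (integrable_const (B ^ 2)) fun x => sq_le_sq.2 ((hle x).trans (le_abs_self B))
  simpa using this

theorem exists_nPointMeasure_nhDist_le {d N : ℕ} (hN : 0 < N) {L : ℝ≥0} (h : C(Torus d, ℝ))
    (hLip : LipschitzWith L h) (π : Measure (Torus d)) [IsProbabilityMeasure π] :
    ∃ ν ∈ nPointMeasures d N, nhDist h ν π ≤ 4 * L * (N : ℝ) ^ (-(1 : ℝ) / d) := by
  have hN1 : (1 : ℝ) ≤ N := by exact_mod_cast hN
  set x : ℝ := (N : ℝ) ^ ((1 : ℝ) / d) with hx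
  have hx1 : 1 ≤ x := Real.one_le_rpow hN1 (by positivity)
  have hm : 0 < ⌊x⌋₊ := Nat.floor_pos.2 hx1
  have hm1 : (1 : ℝ) ≤ ⌊x⌋₊ := by exact_mod_cast hm
  have hmx : (⌊x⌋₊ : ℝ) ≤ x := Nat.floor_le (by linarith)
  have hxm : x < ⌊x⌋₊ + 1 := Nat.lt_floor_add_one x
  have hmN : ⌊x⌋₊ ^ d ≤ N := by
    rcases Nat.eq_zero_or_pos d with rfl | hd
    · simpa using Nat.one_le_iff_ne_zero.2 hN.ne'
    · have h1 : x ^ d = N := by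
        rw [hx, one_div, Real.rpow_inv_natCast_pow (by positivity) hd.ne']
      have h2 : (⌊x⌋₊ : ℝ) ^ d ≤ N := h1 ▸ pow_le_pow_left₀ (by positivity) hmx d
      exact_mod_cast h2
  obtain ⟨p, hp⟩ := exists_nPoint_near hm hN hmN π
  have hmem : (N : ℝ≥0∞)⁻¹ • ∑ i, Measure.dirac (p i) ∈ nPointMeasures d N := ⟨p, rfl⟩
  have := isProbabilityMeasure_of_mem_nPointMeasures hN hmem
  have hinv : (2 : ℝ) / ⌊x⌋₊ ≤ 4 * (N : ℝ) ^ (-(1 : ℝ) / d) := by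
    rw [neg_div, Real.rpow_neg (by positivity), ← hx, ← div_eq_mul_inv,
      div_le_div_iff₀ (by positivity) (by positivity)]
    linarith
  refine ⟨_, hmem, (nhDist_le_of_abs_convDiff_le h _ π (B := L * (2 / ⌊x⌋₊)) (by positivity)
    fun x => ?_).trans ?_⟩
  · rw [convDiff, integral_nPoint p fun y => h (x - y)]
    refine hp L (fun y => h (x - y)) (LipschitzWith.of_dist_le_mul fun y z => ?_)
    refine (hLip.dist_le_mul _ _).trans_eq ?_
    rw [dist_sub_left]
  · calc (L : ℝ) * (2 / ⌊x⌋₊) ≤ L * (4 * (N : ℝ) ^ (-(1 : ℝ) / d)) := by gcongr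
      _ = _ := by ring

theorem exists_nhDist_minimizer {d N : ℕ} (h : C(Torus d, ℝ))
    (π : Measure (Torus d)) [IsProbabilityMeasure π] :
    ∃ μ ∈ nPointMeasures d N, ∀ ν ∈ nPointMeasures d N, nhDist h μ π ≤ nhDist h ν π := by
  let E : (Fin N → Torus d) → ℝ :=
    fun p => nhDist h ((N : ℝ≥0∞)⁻¹ • ∑ i, Measure.dirac (p i)) π
  have hE : Continuous E := by
    refine Real.continuous_sqrt.comp ?_
    have h1 : Continuous (Function.uncurry fun (p : Fin N → Torus d) (x : Torus d) =>
        ((N : ℝ)⁻¹ * ∑ i, h (x - p i) - ∫ y, h (x - y) ∂π) ^ 2) := by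
      have h2 := continuous_conv h π
      refine ((continuous_const.mul (continuous_finsetSum _ fun i _ => ?_)).sub
        (h2.comp continuous_snd)).pow 2
      exact h.continuous.comp
        (continuous_snd.sub ((continuous_apply i).comp continuous_fst))
    have := continuous_parametric_integral_of_continuous
      (μ := (volume : Measure (Torus d))) h1 isCompact_univ
    convert this using 2 with p
    rw [setIntegral_univ]
    refine integral_congr_ae (ae_of_all _ fun x => ?_)
    simp only [convDiff]
    rw [integral_nPoint p fun y => h (x - y)]
  obtain ⟨p, -, hp⟩ := isCompact_univ.exists_isMinOn Set.univ_nonempty hE.continuousOn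
  refine ⟨_, ⟨p, rfl⟩, ?_⟩
  rintro _ ⟨q, rfl⟩
  exact hp (Set.mem_univ q)

theorem integral_abs_le_nhDist {d : ℕ} (h : C(Torus d, ℝ)) (μ ν : Measure (Torus d))
    [IsFiniteMeasure μ] [IsFiniteMeasure ν] : ∫ x, |convDiff h μ ν x| ≤ nhDist h μ ν := by
  have hc := continuous_convDiff h μ ν
  set u := convDiff h μ ν
  refine Real.le_sqrt_of_sq_le ?_
  set a := ∫ x, |u x|
  have h1 : 0 ≤ ∫ x, (|u x| - a) ^ 2 := integral_nonneg fun x => sq_nonneg _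
  have h2 : ∫ x, (|u x| - a) ^ 2 = (∫ x, u x ^ 2) - 2 * a * a + a ^ 2 := by
    have h3 : ∀ x, (|u x| - a) ^ 2 = u x ^ 2 - 2 * a * |u x| + a ^ 2 := fun x => by
      rw [sub_sq, sq_abs]; ring
    simp_rw [h3]
    rw [integral_add, integral_sub, integral_const_mul]
    · simp [a]
    · exact integrable_of_continuous (by fun_prop) _
    · exact integrable_of_continuous (by fun_prop) _
    · exact integrable_of_continuous (by fun_prop) _
    · exact integrable_const _
  nlinarith

theorem mFourier_apply_add {d : ℕ} (n : Fin d → ℤ) (x y : Torus d) :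
    UnitAddTorus.mFourier n (x + y) = UnitAddTorus.mFourier n x * UnitAddTorus.mFourier n y := by
  simp [UnitAddTorus.mFourier, fourier_apply, smul_add, AddCircle.toCircle_add,
    Finset.prod_mul_distrib]

theorem integral_mFourier_mul_conv {d : ℕ} (h : C(Torus d, ℝ)) (μ : Measure (Torus d))
    [IsFiniteMeasure μ] (ξ : Fin d → ℤ) :
    ∫ x, UnitAddTorus.mFourier (-ξ) x * ((∫ y, h (x - y) ∂μ : ℝ) : ℂ) =
      torusFourierCoeff h ξ * ∫ y, UnitAddTorus.mFourier (-ξ) y ∂μ := by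
  have hcont : Continuous (Function.uncurry fun x y : Torus d =>
      UnitAddTorus.mFourier (-ξ) x * (h (x - y) : ℂ)) := by
    unfold Function.uncurry
    fun_prop
  calc ∫ x, UnitAddTorus.mFourier (-ξ) x * ((∫ y, h (x - y) ∂μ : ℝ) : ℂ)
      = ∫ x, ∫ y, UnitAddTorus.mFourier (-ξ) x * (h (x - y) : ℂ) ∂μ := by
        simp_rw [integral_const_mul, integral_complex_ofReal]
    _ = ∫ y, (∫ x, UnitAddTorus.mFourier (-ξ) x * (h (x - y) : ℂ)) ∂μ :=
        integral_integral_swap (hcont.integrable_of_hasCompactSupport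
          (HasCompactSupport.of_compactSpace _))
    _ = ∫ y, torusFourierCoeff h ξ * UnitAddTorus.mFourier (-ξ) y ∂μ := by
        refine integral_congr_ae (ae_of_all _ fun y => ?_)
        simp only
        rw [← integral_add_right_eq_self _ y]
        simp_rw [add_sub_cancel_right, mFourier_apply_add]
        rw [torusFourierCoeff, ← integral_mul_const]
        refine integral_congr_ae (ae_of_all _ fun x => ?_)
        simp only [UnitAddTorus.mFourier, ContinuousMap.coe_mk, Pi.neg_apply]
        ring
    _ = _ := integral_const_mul _ _

theorem norm_torusFourierCoeff_mul_le_nhDist {d : ℕ} (h : C(Torus d, ℝ))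
    (μ ν : Measure (Torus d)) [IsFiniteMeasure μ] [IsFiniteMeasure ν] (ξ : Fin d → ℤ) :
    ‖torusFourierCoeff h ξ‖ *
      ‖∫ y, UnitAddTorus.mFourier (-ξ) y ∂μ - ∫ y, UnitAddTorus.mFourier (-ξ) y ∂ν‖
      ≤ nhDist h μ ν := by
  have h1 : ∫ x, UnitAddTorus.mFourier (-ξ) x * (convDiff h μ ν x : ℂ) =
      torusFourierCoeff h ξ *
        (∫ y, UnitAddTorus.mFourier (-ξ) y ∂μ - ∫ y, UnitAddTorus.mFourier (-ξ) y ∂ν) := by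
    rw [mul_sub, ← integral_mFourier_mul_conv, ← integral_mFourier_mul_conv, ← integral_sub]
    · simp only [convDiff, Complex.ofReal_sub, mul_sub]
    · have := continuous_conv h μ
      exact integrable_of_continuous (by fun_prop) _
    · have := continuous_conv h ν
      exact integrable_of_continuous (by fun_prop) _
  rw [← norm_mul, ← h1]
  refine (norm_integral_le_integral_norm _).trans (le_trans ?_ (integral_abs_le_nhDist h μ ν))
  have hc := continuous_convDiff h μ ν
  refine integral_mono (integrable_of_continuous (by fun_prop) _)
    (integrable_of_continuous (by fun_prop) _) fun x => ?_
  simp only [norm_mul, Complex.norm_real, Real.norm_eq_abs]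
  refine mul_le_of_le_one_left (abs_nonneg _) ?_
  exact ((UnitAddTorus.mFourier (-ξ)).norm_coe_le_norm x).trans_eq UnitAddTorus.mFourier_norm

theorem norm_integral_sub_le {d : ℕ} (μ : Measure (Torus d)) [IsProbabilityMeasure μ]
    (f g : C(Torus d, ℂ)) : ‖∫ x, f x ∂μ - ∫ x, g x ∂μ‖ ≤ ‖f - g‖ := by
  rw [← integral_sub (integrable_of_continuous f.continuous μ)
    (integrable_of_continuous g.continuous μ)]
  refine (norm_integral_le_of_norm_le_const (μ := μ) (C := ‖f - g‖)
    (ae_of_all _ fun x => (f - g).norm_coe_le_norm x)).trans (by simp)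

/-- Convergence of all Fourier coefficients implies weak convergence. -/
theorem tendsto_integral_of_tendsto_mFourier {d : ℕ} {ν : ℕ → Measure (Torus d)}
    [∀ N, IsProbabilityMeasure (ν N)] {π : Measure (Torus d)} [IsProbabilityMeasure π]
    (hν : ∀ n : Fin d → ℤ, Tendsto (fun N => ∫ x, UnitAddTorus.mFourier n x ∂(ν N)) atTop
      (𝓝 (∫ x, UnitAddTorus.mFourier n x ∂π))) (f : C(Torus d, ℂ)) :
    Tendsto (fun N => ∫ x, f x ∂(ν N)) atTop (𝓝 (∫ x, f x ∂π)) := by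
  have hspan : ∀ g ∈ Submodule.span ℂ (Set.range (UnitAddTorus.mFourier (d := Fin d))),
      Tendsto (fun N => ∫ x, g x ∂(ν N)) atTop (𝓝 (∫ x, g x ∂π)) := by
    intro g hg
    induction hg using Submodule.span_induction with
    | mem g hg => obtain ⟨n, rfl⟩ := hg; exact hν n
    | zero => simp
    | add g₁ g₂ _ _ h₁ h₂ =>
      have key : ∀ (μ : Measure (Torus d)) [IsProbabilityMeasure μ],
          ∫ x, (g₁ + g₂) x ∂μ = ∫ x, g₁ x ∂μ + ∫ x, g₂ x ∂μ := fun μ _ =>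
        integral_add (integrable_of_continuous g₁.continuous μ)
          (integrable_of_continuous g₂.continuous μ)
      simp_rw [key]
      exact h₁.add h₂
    | smul a g _ h₁ =>
      simp_rw [ContinuousMap.smul_apply, integral_smul]
      exact h₁.const_smul a
  have hf : f ∈ closure (Submodule.span ℂ (Set.range (UnitAddTorus.mFourier (d := Fin d))) :
      Set C(Torus d, ℂ)) := by
    rw [← Submodule.topologicalClosure_coe, UnitAddTorus.span_mFourier_closure_eq_top]
    trivial
  refine Metric.tendsto_atTop.2 fun ε hε => ?_
  obtain ⟨g, hg, hfg⟩ := Metric.mem_closure_iff.1 hf (ε / 3) (by positivity)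
  obtain ⟨N₀, hN₀⟩ := Metric.tendsto_atTop.1 (hspan g hg) (ε / 3) (by positivity)
  refine ⟨N₀, fun N hN => ?_⟩
  have h1 : dist (∫ x, f x ∂(ν N)) (∫ x, g x ∂(ν N)) < ε / 3 := by
    rw [dist_eq_norm] at hfg ⊢
    exact (norm_integral_sub_le (ν N) f g).trans_lt hfg
  have h2 : dist (∫ x, g x ∂π) (∫ x, f x ∂π) < ε / 3 := by
    rw [dist_comm, dist_eq_norm] at hfg ⊢
    rw [← norm_sub_rev] at hfg
    exact (norm_integral_sub_le π f g).trans_lt hfg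
  have h3 := dist_triangle4 (∫ x, f x ∂(ν N)) (∫ x, g x ∂(ν N)) (∫ x, g x ∂π) (∫ x, f x ∂π)
  have h4 := hN₀ N hN
  linarith

theorem tendsto_integral_of_tendsto_nhDist {d : ℕ} (h : C(Torus d, ℝ))
    (hfc : ∀ ξ : Fin d → ℤ, torusFourierCoeff h ξ ≠ 0) {ν : ℕ → Measure (Torus d)}
    [∀ N, IsProbabilityMeasure (ν N)] {π : Measure (Torus d)} [IsProbabilityMeasure π]
    (hν : Tendsto (fun N => nhDist h (ν N) π) atTop (𝓝 0)) (f : C(Torus d, ℝ)) :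
    Tendsto (fun N => ∫ x, f x ∂(ν N)) atTop (𝓝 (∫ x, f x ∂π)) := by
  have hF : ∀ n : Fin d → ℤ, Tendsto (fun N => ∫ x, UnitAddTorus.mFourier n x ∂(ν N)) atTop
      (𝓝 (∫ x, UnitAddTorus.mFourier n x ∂π)) := by
    intro n
    have hpos : 0 < ‖torusFourierCoeff h (-n)‖ := norm_pos_iff.2 (hfc _)
    refine tendsto_iff_norm_sub_tendsto_zero.2 (squeeze_zero (fun _ => norm_nonneg _)
      (fun N => (le_div_iff₀' hpos).2 ?_) (by simpa using hν.div_const _))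
    simpa using norm_torusFourierCoeff_mul_le_nhDist h (ν N) π (-n)
  have hc := tendsto_integral_of_tendsto_mFourier hF
    (⟨fun x => (f x : ℂ), by fun_prop⟩ : C(Torus d, ℂ))
  simp only [ContinuousMap.coe_mk, integral_complex_ofReal] at hc
  have := (Complex.continuous_re.tendsto _).comp hc
  simpa [Function.comp_def] using this

/-- For a continuous `L`-Lipschitz kernel `h` with nonvanishing Fourier
coefficients and a probability measure `π`: for every `N` the projection on `N`-point
measures admits a solution `μ*_N`; moreover any such sequence of minimizers satisfies
(i) `μ*_N ⇀ π` weakly, and (ii) `N_h(μ*_N − π) = O(L · N^{−1/d})`. -/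
theorem nPoint_projection_exists_and_consistent {d : ℕ} (L : ℝ≥0) (h : C(Torus d, ℝ))
    (hLip : LipschitzWith L (⇑h))
    (hfc : ∀ ξ : Fin d → ℤ, torusFourierCoeff (⇑h) ξ ≠ 0)
    (π : Measure (Torus d)) [IsProbabilityMeasure π] :
    (∀ N : ℕ, 0 < N → ∃ μ ∈ nPointMeasures d N, ∀ ν ∈ nPointMeasures d N,
        nhDist (⇑h) μ π ≤ nhDist (⇑h) ν π) ∧
      ∀ μs : ℕ → Measure (Torus d),
        (∀ N, 0 < N → μs N ∈ nPointMeasures d N ∧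
          ∀ ν ∈ nPointMeasures d N, nhDist (⇑h) (μs N) π ≤ nhDist (⇑h) ν π) →
        ((∀ f : C(Torus d, ℝ),
            Tendsto (fun N => ∫ x, f x ∂(μs N)) atTop (𝓝 (∫ x, f x ∂π))) ∧
          ∃ C : ℝ, ∀ᶠ N : ℕ in atTop,
            nhDist (⇑h) (μs N) π ≤ C * (L : ℝ) * (N : ℝ) ^ (-(1 : ℝ) / d)) := by
  refine ⟨fun N _ => exists_nhDist_minimizer h π, fun μs hμs => ?_⟩
  have hrate : ∀ N : ℕ, 0 < N →
      nhDist h (μs N) π ≤ 4 * (L : ℝ) * (N : ℝ) ^ (-(1 : ℝ) / d) := by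
    intro N hN
    obtain ⟨ν, hν, hle⟩ := exists_nPointMeasure_nhDist_le hN h hLip π
    exact ((hμs N hN).2 ν hν).trans hle
  refine ⟨fun f => ?_, 4, (eventually_gt_atTop 0).mono hrate⟩
  have hprob : ∀ N, IsProbabilityMeasure (μs (N + 1)) := fun N =>
    isProbabilityMeasure_of_mem_nPointMeasures N.succ_pos (hμs _ N.succ_pos).1
  refine (tendsto_add_atTop_iff_nat 1).1 ?_
  rcases Nat.eq_zero_or_pos d with rfl | hd
  · have key : ∀ (μ : Measure (Torus 0)) [IsProbabilityMeasure μ], ∫ x, f x ∂μ = f 0 := by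
      intro μ _
      have h0 : ∀ x, f x = f 0 := fun x => congrArg f (Subsingleton.elim x 0)
      simp_rw [h0]
      simp
    simp_rw [key]
    exact tendsto_const_nhds
  · refine tendsto_integral_of_tendsto_nhDist h hfc
      (squeeze_zero (fun _ => Real.sqrt_nonneg _) (fun N => hrate (N + 1) N.succ_pos) ?_) f
    have hd' : (0 : ℝ) < 1 / d := by positivity
    have := ((tendsto_rpow_neg_atTop hd').comp tendsto_natCast_atTop_atTop).const_mul
      (4 * (L : ℝ))
    rw [mul_zero] at this
    simpa [Function.comp_def, neg_div] using (tendsto_add_atTop_iff_nat 1).2 this
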